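/- arXiv:2511.01843 — 6 statements merged into one kernel-verified Lean document; each statement's English description precedes it below -/
import Mathlib

section
/- Let C₁ and C₂ be two clusters, and let full₁ and full₂ be predicates on nodes. If C₁ satisfies the Partition Availability Conditions (PAC) with respect to full₁ and C₂ satisfies PAC with respect to full₂ (both with respect to the same roster S, succession list L, and replication factor RF), then C₁ and C₂ share at least one node, i.e., C₁ ∩ C₂ is nonempty. -/
/-- The roster replicas: the set of the first `RF` entries of the succession list `L`. -/
def rosterReplicas {α : Type*} [DecidableEq α] (L : List α) (RF : ℕ) : Finset α :=
  (L.take RF).toFinset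

/-- Partition Availability Conditions (PAC) for a cluster `C`, with respect to the
roster `S`, succession list `L`, replication factor `RF`, and the predicate `full`. -/
def PAC {α : Type*} [DecidableEq α] (S : Finset α) (L : List α) (RF : ℕ)
    (full : α → Prop) (C : Finset α) : Prop :=
  -- SuperMajority
  (2 * (C ∩ S).card > S.card ∧ (S \ C).card < RF) ∨
  -- AllRosterReplicas
  (rosterReplicas L RF ⊆ C) ∨
  -- SimpleMajority
  (2 * (C ∩ S).card > S.card ∧ (rosterReplicas L RF ∩ C).Nonempty ∧ ∃ n ∈ C, full n) ∨
  -- HalfRoster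
  (2 * (C ∩ S).card = S.card ∧ (∃ ℓ, L.head? = some ℓ ∧ ℓ ∈ C) ∧ ∃ n ∈ C, full n)

/-- Every PAC cluster meets the roster replicas. -/
theorem pac_meets_replicas {α : Type*} [DecidableEq α]
    (S C : Finset α) (L : List α) (RF : ℕ) (full : α → Prop)
    (hNodup : L.Nodup) (hLS : L.toFinset = S)
    (hRF1 : 1 ≤ RF) (hRF2 : RF ≤ S.card)
    (h : PAC S L RF full C) : ∃ x ∈ rosterReplicas L RF, x ∈ C := by
  have hlen : S.card = L.length := by
    rw [← hLS, List.toFinset_card_of_nodup hNodup]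
  have hcard : (rosterReplicas L RF).card = RF := by
    unfold rosterReplicas
    rw [List.toFinset_card_of_nodup (hNodup.sublist (List.take_sublist _ _)), List.length_take]
    omega
  have hsub : rosterReplicas L RF ⊆ S := by
    intro x hx
    rw [← hLS, List.mem_toFinset]
    exact List.mem_of_mem_take (List.mem_toFinset.1 hx)
  rcases h with ⟨_, h⟩ | h | ⟨_, ⟨x, hx⟩, _⟩ | ⟨_, ⟨l, hl, hlC⟩, _⟩
  · by_contra hn
    push Not at hn
    have : rosterReplicas L RF ⊆ S \ C := fun x hx =>
      Finset.mem_sdiff.2 ⟨hsub hx, hn x hx⟩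
    have := Finset.card_le_card this
    omega
  · obtain ⟨x, hx⟩ := Finset.card_pos.1 (by omega : 0 < (rosterReplicas L RF).card)
    exact ⟨x, hx, h hx⟩
  · exact ⟨x, (Finset.mem_inter.1 hx).1, (Finset.mem_inter.1 hx).2⟩
  · refine ⟨l, ?_, hlC⟩
    unfold rosterReplicas
    rw [List.mem_toFinset]
    obtain ⟨k, rfl⟩ : ∃ k, RF = k + 1 := ⟨RF - 1, by omega⟩
    cases L with
    | nil => simp at hl
    | cons a t => simp at hl; simp [hl]

/-- PAC cluster: all replicas, strict majority, or half with the leader. -/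
theorem pac_cases {α : Type*} [DecidableEq α]
    (S C : Finset α) (L : List α) (RF : ℕ) (full : α → Prop)
    (h : PAC S L RF full C) : rosterReplicas L RF ⊆ C ∨ S.card < 2 * (C ∩ S).card ∨
      (2 * (C ∩ S).card = S.card ∧ ∃ l, L.head? = some l ∧ l ∈ C) := by
  rcases h with ⟨h, _⟩ | h | ⟨h, _⟩ | ⟨h, h', _⟩
  · exact Or.inr (Or.inl h)
  · exact Or.inl h
  · exact Or.inr (Or.inl h)
  · exact Or.inr (Or.inr ⟨h, h'⟩)

/-- Two clusters both satisfying PAC (with respect to the same roster, succession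
list, and replication factor) share at least one node. -/
theorem pac_clusters_intersect {α : Type*} [DecidableEq α]
    (S C₁ C₂ : Finset α) (L : List α) (RF : ℕ) (full₁ full₂ : α → Prop)
    (hNodup : L.Nodup) (hLS : L.toFinset = S)
    (hRF1 : 1 ≤ RF) (hRF2 : RF ≤ S.card)
    (hPAC₁ : PAC S L RF full₁ C₁) (hPAC₂ : PAC S L RF full₂ C₂) :
    (C₁ ∩ C₂).Nonempty := by
  obtain ⟨x, hxR, hx⟩ := pac_meets_replicas S C₁ L RF full₁ hNodup hLS hRF1 hRF2 hPAC₁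
  obtain ⟨y, hyR, hy⟩ := pac_meets_replicas S C₂ L RF full₂ hNodup hLS hRF1 hRF2 hPAC₂
  have key : S.card < (C₁ ∩ S).card + (C₂ ∩ S).card → (C₁ ∩ C₂).Nonempty := by
    intro h
    by_contra hn
    have hd : Disjoint C₁ C₂ :=
      Finset.disjoint_iff_inter_eq_empty.2 (Finset.not_nonempty_iff_eq_empty.1 hn)
    have hd' : Disjoint (C₁ ∩ S) (C₂ ∩ S) :=
      hd.mono Finset.inter_subset_left Finset.inter_subset_left
    have h1 := Finset.card_union_of_disjoint hd'
    have h2 := Finset.card_le_card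
      (Finset.union_subset (Finset.inter_subset_right (s₁ := C₁) (s₂ := S))
        (Finset.inter_subset_right (s₁ := C₂) (s₂ := S)))
    omega
  rcases pac_cases S C₁ L RF full₁ hPAC₁ with h1 | h1 | ⟨h1, l, hl, hlC⟩
  · exact ⟨y, Finset.mem_inter.2 ⟨h1 hyR, hy⟩⟩
  all_goals rcases pac_cases S C₂ L RF full₂ hPAC₂ with h2 | h2 | ⟨h2, m, hm, hmC⟩
  · exact ⟨x, Finset.mem_inter.2 ⟨hx, h2 hxR⟩⟩
  · exact key (by omega)
  · exact key (by omega)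
  · exact ⟨x, Finset.mem_inter.2 ⟨hx, h2 hxR⟩⟩
  · exact key (by omega)
  · have : l = m := Option.some.inj (hl.symm.trans hm)
    subst this
    exact ⟨l, Finset.mem_inter.2 ⟨hlC, hmC⟩⟩
end

section
/- Let C₁ and C₂ be two disjoint clusters (C₁ ∩ C₂ = ∅), and let full₁ and full₂ be predicates on nodes. Then it is impossible for both C₁ to satisfy the Partition Availability Conditions (PAC) with respect to full₁ and C₂ to satisfy PAC with respect to full₂ (both with respect to the same roster S, succession list L, and replication factor RF). Consequently, since distinct clusters produced by the global membership consensus are pairwise disjoint, during any regime at most one cluster in the system satisfies PAC for a given partition. -/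
theorem pac_weaken {α : Type*} [DecidableEq α] (S C : Finset α) (L : List α) (RF : ℕ)
    (full : α → Prop) (hNodup : L.Nodup) (hLS : L.toFinset = S)
    (hRF1 : 1 ≤ RF) (hRF2 : RF ≤ S.card) (h : PAC S L RF full C) :
    (rosterReplicas L RF ∩ C).Nonempty ∧ (rosterReplicas L RF ⊆ C ∨
      2 * (C ∩ S).card > S.card ∨
      (2 * (C ∩ S).card = S.card ∧ ∃ l, L.head? = some l ∧ l ∈ C)) := by
  have hlen : L.length = S.card := by rw [← hLS, List.toFinset_card_of_nodup hNodup]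
  have hcard : (rosterReplicas L RF).card = RF := by
    unfold rosterReplicas
    rw [List.toFinset_card_of_nodup (hNodup.sublist (List.take_sublist _ _)), List.length_take]
    omega
  have hsub : rosterReplicas L RF ⊆ S := by
    intro x hx
    rw [← hLS, List.mem_toFinset]
    exact List.mem_of_mem_take (List.mem_toFinset.1 hx)
  rcases h with ⟨h1, h2⟩ | h | ⟨h1, h2, -⟩ | ⟨h1, ⟨l, hl, hlC⟩, -⟩
  · refine ⟨?_, Or.inr (Or.inl h1)⟩
    by_contra hne
    rw [Finset.not_nonempty_iff_eq_empty] at hne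
    have : rosterReplicas L RF ⊆ S \ C := by
      intro x hx
      refine Finset.mem_sdiff.2 ⟨hsub hx, fun hxC => ?_⟩
      have hm := Finset.mem_inter.2 ⟨hx, hxC⟩
      rw [hne] at hm
      exact absurd hm (Finset.notMem_empty x)
    have := Finset.card_le_card this
    omega
  · refine ⟨?_, Or.inl h⟩
    rw [Finset.inter_eq_left.2 h, ← Finset.card_pos]
    omega
  · exact ⟨h2, Or.inr (Or.inl h1)⟩
  · refine ⟨⟨l, Finset.mem_inter.2 ⟨?_, hlC⟩⟩, Or.inr (Or.inr ⟨h1, l, hl, hlC⟩)⟩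
    unfold rosterReplicas
    rw [List.mem_toFinset]
    apply List.mem_of_mem_head?
    rw [List.head?_take, if_neg (by omega)]
    exact hl

/-- Two disjoint clusters cannot both satisfy PAC (with respect to the same roster,
succession list, and replication factor): at most one cluster in the system can
satisfy PAC for a given partition during any regime. -/
theorem pac_at_most_one_cluster {α : Type*} [DecidableEq α]
    (S C₁ C₂ : Finset α) (L : List α) (RF : ℕ) (full₁ full₂ : α → Prop)
    (hNodup : L.Nodup) (hLS : L.toFinset = S)
    (hRF1 : 1 ≤ RF) (hRF2 : RF ≤ S.card)
    (hdisj : C₁ ∩ C₂ = ∅) :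
    ¬ (PAC S L RF full₁ C₁ ∧ PAC S L RF full₂ C₂) := by
  rintro ⟨h1, h2⟩
  obtain ⟨⟨x, hx⟩, h1⟩ := pac_weaken S C₁ L RF full₁ hNodup hLS hRF1 hRF2 h1
  obtain ⟨⟨y, hy⟩, h2⟩ := pac_weaken S C₂ L RF full₂ hNodup hLS hRF1 hRF2 h2
  rw [Finset.mem_inter] at hx hy
  have hd : ∀ z, z ∈ C₁ → z ∈ C₂ → False := by
    intro z hz1 hz2
    have hm := Finset.mem_inter.2 ⟨hz1, hz2⟩
    rw [hdisj] at hm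
    exact absurd hm (Finset.notMem_empty z)
  have hc : (C₁ ∩ S).card + (C₂ ∩ S).card ≤ S.card := by
    rw [← Finset.card_union_of_disjoint]
    · exact Finset.card_le_card (Finset.union_subset Finset.inter_subset_right
        Finset.inter_subset_right)
    · exact Finset.disjoint_left.2 fun z hz1 hz2 =>
        hd z (Finset.mem_inter.1 hz1).1 (Finset.mem_inter.1 hz2).1
  rcases h1 with h1 | h1
  · exact hd y (h1 hy.1) hy.2
  rcases h2 with h2 | h2
  · exact hd x hx.2 (h2 hx.1)
  rcases h1 with h1 | ⟨h1, l, hl, hlC⟩ <;> rcases h2 with h2 | ⟨h2, m, hm, hmC⟩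
  · omega
  · omega
  · omega
  · rw [hl] at hm
    obtain rfl := Option.some.inj hm
    exact hd _ hlC hmC
end

section
/- Let C₁ and C₂ be two clusters and let full₁ and full₂ be predicates on nodes. Suppose: (i) C₁ satisfies the Partition Availability Conditions (PAC) with respect to full₁; (ii) C₂ satisfies PAC with respect to full₂; and (iii) every node satisfying full₂ belongs to Replicas(C₁), the set of cluster replicas of C₁ (this encodes that C₁ was the most recent regime in which the partition was available, so a node can only be full for the partition if it was a cluster replica of C₁). Then at least one cluster replica of C₁ is also present in C₂, i.e., Replicas(C₁) ∩ C₂ is nonempty. -/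
/-- The cluster replicas of a cluster `C`: the set of the first `RF` entries of the
sublist of the succession list `L` consisting of entries belonging to `C`. -/
def clusterReplicas {α : Type*} [DecidableEq α] (L : List α) (RF : ℕ)
    (C : Finset α) : Finset α :=
  ((L.filter (fun x => x ∈ C)).take RF).toFinset

theorem aux_sub {α : Type*} [DecidableEq α] (L : List α) (RF : ℕ) (C : Finset α) :
    rosterReplicas L RF ∩ C ⊆ clusterReplicas L RF C := by
  intro x hx
  simp only [rosterReplicas, Finset.mem_inter, List.mem_toFinset] at hx
  simp only [clusterReplicas, List.mem_toFinset]
  have h1 : x ∈ (L.take RF).filter (fun x => x ∈ C) := by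
    simp [List.mem_filter, hx.1, hx.2]
  have hlen : ((L.take RF).filter (fun x => decide (x ∈ C))).length ≤ RF :=
    (List.length_filter_le _ _).trans (List.length_take_le _ _)
  rw [← List.take_append_drop RF L, List.filter_append, List.take_append,
    List.take_of_length_le hlen]
  exact List.mem_append_left _ h1

theorem aux_card {α : Type*} [DecidableEq α] (L : List α) (RF : ℕ) (C : Finset α)
    (hN : L.Nodup) :
    (clusterReplicas L RF C).card = RF ∨ clusterReplicas L RF C = C ∩ L.toFinset := by
  by_cases h : RF ≤ (L.filter (fun x => decide (x ∈ C))).length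
  · left
    rw [clusterReplicas, List.toFinset_card_of_nodup
      ((hN.filter _).sublist (List.take_sublist _ _)), List.length_take]
    exact min_eq_left h
  · right
    rw [clusterReplicas, List.take_of_length_le (by omega)]
    ext x
    simp [and_comm]

theorem aux_subS {α : Type*} [DecidableEq α] (L : List α) (RF : ℕ) (C : Finset α) :
    clusterReplicas L RF C ⊆ L.toFinset := by
  intro x hx
  simp only [clusterReplicas, List.mem_toFinset] at hx ⊢
  exact List.mem_of_mem_filter (List.mem_of_mem_take hx)

/-- If `C₁` and `C₂` both satisfy PAC, and every node that is full (for the `C₂`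
availability check) is a cluster replica of `C₁`—encoding that `C₁` was the most
recent regime in which the partition was available—then at least one cluster
replica of `C₁` is present in `C₂`. -/
theorem cluster_replica_survives {α : Type*} [DecidableEq α]
    (S C₁ C₂ : Finset α) (L : List α) (RF : ℕ) (full₁ full₂ : α → Prop)
    (hNodup : L.Nodup) (hLS : L.toFinset = S)
    (hRF1 : 1 ≤ RF) (hRF2 : RF ≤ S.card)
    (hPAC₁ : PAC S L RF full₁ C₁) (hPAC₂ : PAC S L RF full₂ C₂)
    (hfull₂ : ∀ n, full₂ n → n ∈ clusterReplicas L RF C₁) :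
    (clusterReplicas L RF C₁ ∩ C₂).Nonempty := by
  subst hLS
  have hRc : (rosterReplicas L RF).card = RF := by
    rw [List.toFinset_card_of_nodup hNodup] at hRF2
    rw [rosterReplicas, List.toFinset_card_of_nodup
      (hNodup.sublist (List.take_sublist _ _)), List.length_take]
    exact min_eq_left hRF2
  have hRS : rosterReplicas L RF ⊆ L.toFinset := by
    intro x hx
    simp only [rosterReplicas, List.mem_toFinset] at hx ⊢
    exact List.mem_of_mem_take hx
  -- a subset of the roster larger than the complement of C meets C
  have key : ∀ A C : Finset α, A ⊆ L.toFinset → (L.toFinset \ C).card < A.card →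
      (A ∩ C).Nonempty := by
    intro A C hA hc
    by_contra hne
    have hsub : A ⊆ L.toFinset \ C := fun x hx =>
      Finset.mem_sdiff.2 ⟨hA hx, fun hxC => hne ⟨x, Finset.mem_inter.2 ⟨hx, hxC⟩⟩⟩
    exact absurd (Finset.card_le_card hsub) (by omega)
  have hfin : (∃ n ∈ C₂, full₂ n) → (clusterReplicas L RF C₁ ∩ C₂).Nonempty := by
    rintro ⟨n, hn, hf⟩
    exact ⟨n, Finset.mem_inter.2 ⟨hfull₂ n hf, hn⟩⟩
  rcases hPAC₂ with ⟨hmaj, hlt⟩ | hall | ⟨-, -, h⟩ | ⟨-, -, h⟩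
  · apply key _ _ (aux_subS L RF C₁)
    rcases aux_card L RF C₁ hNodup with h | h
    · omega
    · have hs : (L.toFinset \ C₂).card + (C₂ ∩ L.toFinset).card = L.toFinset.card := by
        rw [Finset.inter_comm]; exact Finset.card_sdiff_add_card_inter _ _
      rcases hPAC₁ with ⟨h1, -⟩ | h1 | ⟨h1, -⟩ | ⟨h1, -⟩
      · rw [h]; omega
      · have := Finset.card_le_card (Finset.subset_inter h1 hRS)
        rw [h]; omega
      · rw [h]; omega
      · rw [h]; omega
  · have hne : (rosterReplicas L RF ∩ C₁).Nonempty := by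
      rcases hPAC₁ with ⟨-, h1⟩ | h1 | ⟨-, h1, -⟩ | ⟨-, ⟨l, hl, hlC⟩, -⟩
      · exact key _ _ hRS (by omega)
      · rw [Finset.inter_eq_left.2 h1]
        exact Finset.card_pos.1 (by omega)
      · exact h1
      · refine ⟨l, Finset.mem_inter.2 ⟨?_, hlC⟩⟩
        cases L with
        | nil => simp at hl
        | cons a t =>
          obtain ⟨k, rfl⟩ := Nat.exists_eq_add_of_le' hRF1
          simp at hl
          simp [rosterReplicas, hl]
    obtain ⟨x, hx⟩ := hne
    exact ⟨x, Finset.mem_inter.2 ⟨aux_sub L RF C₁ hx, hall (Finset.mem_inter.1 hx).1⟩⟩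
  · exact hfin h
  · exact hfin h
end

section
/- Let S be a finite set of nodes with succession list L (a duplicate-free list whose set of entries is exactly S), and fix RF with 1 ≤ RF ≤ |S|. Let C₁ and C₂ be clusters such that C₁ contains at least RF nodes of S (so that Replicas(C₁), the first RF entries of the sublist of L consisting of entries belonging to C₁, has exactly RF elements) and fewer than RF nodes of S are missing from C₂, i.e., |S \ C₂| < RF. Then Replicas(C₁) ∩ C₂ is nonempty. -/
/-- SuperMajority case: if `C₁` contains at least `RF` nodes of the roster `S`
(so its cluster-replica set has exactly `RF` elements) and fewer than `RF` roster
nodes are missing from `C₂`, then some cluster replica of `C₁` belongs to `C₂`. -/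
theorem cluster_replica_meets_supermajority {α : Type*} [DecidableEq α]
    (S C₁ C₂ : Finset α) (L : List α) (RF : ℕ)
    (hNodup : L.Nodup) (hLS : L.toFinset = S)
    (hRF1 : 1 ≤ RF) (hRF2 : RF ≤ S.card)
    (hC₁ : RF ≤ (C₁ ∩ S).card) (hC₂ : (S \ C₂).card < RF) :
    (clusterReplicas L RF C₁ ∩ C₂).Nonempty := by
  have hn : (L.filter (fun x => x ∈ C₁)).Nodup := hNodup.filter _
  have hcard : (clusterReplicas L RF C₁).card = RF := by
    unfold clusterReplicas
    rw [List.toFinset_card_of_nodup (hn.sublist (List.take_sublist _ _)), List.length_take]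
    have h : (L.filter (fun x => x ∈ C₁)).length = (C₁ ∩ S).card := by
      rw [← List.toFinset_card_of_nodup hn]
      congr 1
      ext x
      simp [← hLS, and_comm]
    rw [h]
    exact min_eq_left hC₁
  have hsub : clusterReplicas L RF C₁ ⊆ S := by
    intro x hx
    unfold clusterReplicas at hx
    rw [List.mem_toFinset] at hx
    rw [← hLS, List.mem_toFinset]
    exact (List.mem_filter.mp (List.mem_of_mem_take hx)).1
  by_contra hne
  rw [Finset.not_nonempty_iff_eq_empty] at hne
  have hle : clusterReplicas L RF C₁ ⊆ S \ C₂ := by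
    intro x hx
    rw [Finset.mem_sdiff]
    refine ⟨hsub hx, fun h2 => ?_⟩
    have : x ∈ clusterReplicas L RF C₁ ∩ C₂ := Finset.mem_inter.mpr ⟨hx, h2⟩
    rw [hne] at this
    simp at this
  have := Finset.card_le_card hle
  omega
end

section
/- For every integer f ≥ 1 and every real u with 0 < u < 1, LARK's per-partition unavailability is strictly smaller than the majority-quorum per-partition unavailability: u^{f+1} < ∑_{k=f+1}^{2f+1} binomial(2f+1, k) · u^k · (1−u)^{(2f+1)−k}. -/
/-- LARK's per-partition unavailability `u^(f+1)` is strictly smaller than the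
majority-quorum per-partition unavailability
`∑_{k=f+1}^{2f+1} C(2f+1,k) u^k (1-u)^(2f+1-k)` for every `f ≥ 1` and `0 < u < 1`. -/
theorem lark_unavail_lt_majority_unavail (f : ℕ) (hf : 1 ≤ f)
    (u : ℝ) (hu0 : 0 < u) (hu1 : u < 1) :
    u ^ (f + 1) <
      ∑ k ∈ Finset.Icc (f + 1) (2 * f + 1),
        ((2 * f + 1).choose k : ℝ) * u ^ k * (1 - u) ^ ((2 * f + 1) - k) := by
  have h1 : (0:ℝ) < 1 - u := by linarith
  have hL : u ^ (f + 1) = ∑ j ∈ Finset.range (f + 1),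
      (f.choose j : ℝ) * u ^ (f + 1 + j) * (1 - u) ^ (f - j) := by
    have h := add_pow u (1 - u) f
    rw [add_sub_cancel, one_pow] at h
    calc u ^ (f + 1) = u ^ (f + 1) * 1 := by ring
      _ = u ^ (f + 1) * ∑ m ∈ Finset.range (f + 1),
          u ^ m * (1 - u) ^ (f - m) * (f.choose m : ℝ) := congrArg (u ^ (f + 1) * ·) h
      _ = _ := by
        rw [Finset.mul_sum]
        refine Finset.sum_congr rfl fun j _ => ?_
        rw [pow_add u (f + 1) j]
        ring
  have hR : ∑ k ∈ Finset.Icc (f + 1) (2 * f + 1),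
        ((2 * f + 1).choose k : ℝ) * u ^ k * (1 - u) ^ ((2 * f + 1) - k) =
      ∑ j ∈ Finset.range (f + 1),
        ((2 * f + 1).choose (f + 1 + j) : ℝ) * u ^ (f + 1 + j) * (1 - u) ^ (f - j) := by
    have hI : Finset.Icc (f + 1) (2 * f + 1) = Finset.Ico (f + 1) (2 * f + 2) := by
      ext k
      simp only [Finset.mem_Icc, Finset.mem_Ico]
      omega
    rw [hI, Finset.sum_Ico_eq_sum_range]
    have e : 2 * f + 2 - (f + 1) = f + 1 := by omega
    rw [e]
    refine Finset.sum_congr rfl fun j _ => ?_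
    have e2 : 2 * f + 1 - (f + 1 + j) = f - j := by omega
    rw [e2]
  rw [hL, hR]
  apply Finset.sum_lt_sum
  · intro j hj
    have hj' : j ≤ f := by
      have := Finset.mem_range.mp hj
      omega
    have hc : f.choose j ≤ (2 * f + 1).choose (f + 1 + j) := by
      rw [← Nat.choose_symm hj', ← Nat.choose_symm (show f + 1 + j ≤ 2 * f + 1 by omega),
        show 2 * f + 1 - (f + 1 + j) = f - j by omega]
      exact Nat.choose_le_choose _ (by omega)
    have hc' : (f.choose j : ℝ) ≤ ((2 * f + 1).choose (f + 1 + j) : ℝ) := by exact_mod_cast hc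
    gcongr
  · refine ⟨0, by simp, ?_⟩
    have hc : f.choose 0 < (2 * f + 1).choose (f + 1 + 0) := by
      have a := Nat.choose_pos (show f ≤ 2 * f by omega)
      have b := Nat.choose_pos (show f + 1 ≤ 2 * f by omega)
      rw [Nat.add_zero, Nat.choose_succ_succ, Nat.choose_zero_right]
      simp only [Nat.succ_eq_add_one]
      omega
    have hc' : (f.choose 0 : ℝ) < ((2 * f + 1).choose (f + 1 + 0) : ℝ) := by exact_mod_cast hc
    have p1 : (0:ℝ) < u ^ (f + 1 + 0) := by positivity
    have p2 : (0:ℝ) < (1 - u) ^ (f - 0) := pow_pos h1 _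
    exact mul_lt_mul_of_pos_right (mul_lt_mul_of_pos_right hc' p1) p2
end

section
/- For every integer f ≥ 1, the ratio of majority-quorum unavailability to LARK unavailability tends to the binomial coefficient binomial(2f+1, f+1) as the per-node unavailability tends to zero: the function u ↦ (∑_{k=f+1}^{2f+1} binomial(2f+1, k) · u^k · (1−u)^{(2f+1)−k}) / u^{f+1} tends to binomial(2f+1, f+1) as u → 0 from the right. In particular the limiting improvement factor equals 3 for f = 1, 10 for f = 2, and 35 for f = 3. -/
open Filter

/-- The ratio of majority-quorum unavailability to LARK unavailability tends to
`C(2f+1, f+1)` as the per-node unavailability `u` tends to `0` from within `(0,1)`;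
in particular, the limiting improvement factor is `3` for `f = 1`, `10` for `f = 2`,
and `35` for `f = 3`. -/
theorem majority_over_lark_ratio_tendsto_choose (f : ℕ) (hf : 1 ≤ f) :
    Tendsto
      (fun u : ℝ =>
        (∑ k ∈ Finset.Icc (f + 1) (2 * f + 1),
          ((2 * f + 1).choose k : ℝ) * u ^ k * (1 - u) ^ ((2 * f + 1) - k)) /
          u ^ (f + 1))
      (nhdsWithin 0 (Set.Ioo (0 : ℝ) 1))
      (nhds (((2 * f + 1).choose (f + 1) : ℝ))) ∧
    (2 * 1 + 1).choose (1 + 1) = 3 ∧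
    (2 * 2 + 1).choose (2 + 1) = 10 ∧
    (2 * 3 + 1).choose (3 + 1) = 35 := by
  refine ⟨?_, by decide, by decide, by decide⟩
  let g : ℝ → ℝ := fun u => ∑ k ∈ Finset.Icc (f + 1) (2 * f + 1),
    ((2 * f + 1).choose k : ℝ) * u ^ (k - (f + 1)) * (1 - u) ^ ((2 * f + 1) - k)
  have hg : Continuous g := by
    show Continuous (fun u : ℝ => ∑ k ∈ Finset.Icc (f + 1) (2 * f + 1),
      ((2 * f + 1).choose k : ℝ) * u ^ (k - (f + 1)) * (1 - u) ^ ((2 * f + 1) - k))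
    fun_prop
  have h0 : g 0 = ((2 * f + 1).choose (f + 1) : ℝ) := by
    show (∑ k ∈ Finset.Icc (f + 1) (2 * f + 1),
      ((2 * f + 1).choose k : ℝ) * (0 : ℝ) ^ (k - (f + 1)) * (1 - 0) ^ ((2 * f + 1) - k)) = _
    rw [Finset.sum_eq_single (f + 1)]
    · simp
    · intro k hk hne
      rw [Finset.mem_Icc] at hk
      have : k - (f + 1) ≠ 0 := by omega
      simp [zero_pow this]
    · intro h
      exact absurd (Finset.mem_Icc.mpr ⟨le_rfl, by omega⟩) h
  have ht : Tendsto g (nhdsWithin 0 (Set.Ioo (0 : ℝ) 1))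
      (nhds (((2 * f + 1).choose (f + 1) : ℝ))) := by
    rw [← h0]
    exact (hg.tendsto 0).mono_left nhdsWithin_le_nhds
  refine ht.congr' ?_
  filter_upwards [self_mem_nhdsWithin] with u hu
  have hu0 : u ≠ 0 := ne_of_gt hu.1
  rw [eq_div_iff (pow_ne_zero _ hu0), Finset.sum_mul]
  refine Finset.sum_congr rfl fun k hk => ?_
  rw [Finset.mem_Icc] at hk
  have e : u ^ k = u ^ (k - (f + 1)) * u ^ (f + 1) := by
    rw [← pow_add, Nat.sub_add_cancel hk.1]
  rw [e]
  ring
end
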